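/- arXiv:2501.15419 — 2 statements merged into one kernel-verified Lean document; each statement's English description precedes it below -/
import Mathlib

section
/- Fix x ∈ E with g_i(x) > 0 for all i, z ∈ ℝ^m with z_i > 0 for all i, μ > 0, κ_C > 0 and τ ∈ (0, 1/4), and suppose q_μ(x) ≠ 0. Then there exists Δ̄ > 0 such that for every Δ ∈ (0, Δ̄] and every d ∈ E with ‖d‖ ≤ Δ and pred_{x,z,μ}(d) ≥ κ_C ‖q_μ(x)‖ Δ, the step d is successful: g_i(x+d) > 0 for all i and ared_{x,μ}(d) > τ pred_{x,z,μ}(d). (For Δ ≤ ‖q_μ(x)‖/‖H(x,z)‖_op the Cauchy-decrease condition pred_{x,z,μ}(d) ≥ κ_C ‖q_μ(x)‖ min(Δ, ‖q_μ(x)‖/‖H(x,z)‖_op) takes exactly this form; hence at a point with q_μ(x) ≠ 0 a sufficiently shrunken trust region always yields a successful iteration.) -/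
open Filter Topology
open scoped RealInnerProductSpace BigOperators

noncomputable section

variable {E : Type*} [NormedAddCommGroup E] [InnerProductSpace ℝ E] [FiniteDimensional ℝ E]

/-- A forcing function: continuous on `[0,∞)`, nonnegative there, vanishing exactly at `0`. -/
def IsForcing (ρ : ℝ → ℝ) : Prop :=
  ContinuousOn ρ (Set.Ici 0) ∧ (∀ t, 0 ≤ t → 0 ≤ ρ t) ∧ ∀ t, 0 ≤ t → (ρ t = 0 ↔ t = 0)

/-- The Hessian of `h` at `x`, i.e. the derivative of the gradient field of `h` at `x`. -/
def Hess (h : E → ℝ) (x : E) : E →L[ℝ] E := fderiv ℝ (gradient h) x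

/-- Gradient of the Lagrangian `L(x,z) = f(x) - ∑ i, z i * g i x` with respect to `x`. -/
def gradL {m : ℕ} (f : E → ℝ) (g : Fin m → E → ℝ) (x : E) (z : Fin m → ℝ) : E :=
  gradient f x - ∑ i, z i • gradient (g i) x

/-- Hessian of the Lagrangian with respect to `x`. -/
def hessL {m : ℕ} (f : E → ℝ) (g : Fin m → E → ℝ) (x : E) (z : Fin m → ℝ) : E →L[ℝ] E :=
  Hess f x - ∑ i, z i • Hess (g i) x

/-- The condensed primal-dual operator `H(x,z)`,
`H(x,z) v = Hess_x L(x,z) v + ∑ i (z i / g i x) ⟪∇g i x, v⟫ ∇g i x`. -/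
def Hxz {m : ℕ} (f : E → ℝ) (g : Fin m → E → ℝ) (x : E) (z : Fin m → ℝ) : E →L[ℝ] E :=
  hessL f g x z +
    ∑ i, (z i / g i x) • ((innerSL ℝ (gradient (g i) x)).smulRight (gradient (g i) x))

/-- Smallest Rayleigh-quotient value of `A` over the unit sphere. -/
def lamMin (A : E →L[ℝ] E) : ℝ := sInf ((fun v => ⟪A v, v⟫) '' {v : E | ‖v‖ = 1})

/-- The log-barrier merit function `φ_μ`. -/
def barrierPhi {m : ℕ} (μ : ℝ) (f : E → ℝ) (g : Fin m → E → ℝ) (x : E) : ℝ :=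
  f x - μ * ∑ i, Real.log (g i x)

/-- The barrier gradient `q_μ(x) = ∇f(x) - μ ∑ i ∇g i (x) / g i x`. -/
def qmu {m : ℕ} (μ : ℝ) (f : E → ℝ) (g : Fin m → E → ℝ) (x : E) : E :=
  gradient f x - μ • ∑ i, (g i x)⁻¹ • gradient (g i) x

/-- Trust-region model `m_{x,z,μ}(d)`. -/
def trModel {m : ℕ} (μ : ℝ) (f : E → ℝ) (g : Fin m → E → ℝ) (x : E) (z : Fin m → ℝ)
    (d : E) : ℝ :=
  (1/2) * ⟪Hxz f g x z d, d⟫ + ⟪qmu μ f g x, d⟫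

/-- Predicted reduction of the step `d`. -/
def predRed {m : ℕ} (μ : ℝ) (f : E → ℝ) (g : Fin m → E → ℝ) (x : E) (z : Fin m → ℝ)
    (d : E) : ℝ :=
  - trModel μ f g x z d

/-- Actual reduction of the step `d`. -/
def aredRed {m : ℕ} (μ : ℝ) (f : E → ℝ) (g : Fin m → E → ℝ) (x : E) (d : E) : ℝ :=
  barrierPhi μ f g x - barrierPhi μ f g (x + d)


/-- At a strictly feasible point, `q_μ` is the gradient of the log-barrier merit function. -/
theorem hasGradientAt_barrierPhi {m : ℕ} (μ : ℝ) {f : E → ℝ} {g : Fin m → E → ℝ} {x : E}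
    (hf : DifferentiableAt ℝ f x) (hg : ∀ i, DifferentiableAt ℝ (g i) x) (hgx : ∀ i, g i x ≠ 0) :
    HasGradientAt (barrierPhi μ f g) (qmu μ f g x) x := by
  rw [hasGradientAt_iff_hasFDerivAt]
  have hlog : HasFDerivAt (fun y => ∑ i, Real.log (g i y))
      (∑ i, (g i x)⁻¹ • InnerProductSpace.toDual ℝ E (gradient (g i) x)) x :=
    HasFDerivAt.fun_sum fun i _ => (hg i).hasGradientAt.hasFDerivAt.log (hgx i)
  have h := hf.hasGradientAt.hasFDerivAt.sub (hlog.const_mul μ)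
  refine h.congr_fderiv ?_
  simp [qmu]

/-- If `‖d‖ ≤ Δ`, the quadratic form of `A` at `d` is at most `‖A‖ Δ²` in absolute value. -/
theorem abs_inner_apply_self_le {F : Type*} [NormedAddCommGroup F] [InnerProductSpace ℝ F]
    (A : F →L[ℝ] F) {d : F} {Δ : ℝ} (hd : ‖d‖ ≤ Δ) :
    |⟪A d, d⟫| ≤ ‖A‖ * Δ * Δ := by
  have hΔ : 0 ≤ Δ := (norm_nonneg d).trans hd
  calc |⟪A d, d⟫| ≤ ‖A d‖ * ‖d‖ := abs_real_inner_le_norm _ _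
    _ ≤ ‖A‖ * ‖d‖ * ‖d‖ := by gcongr; exact A.le_opNorm d
    _ ≤ ‖A‖ * Δ * Δ := by gcongr

/-- At a strictly feasible point with nonvanishing barrier gradient,
every Cauchy-decrease step in a sufficiently shrunken trust region is successful. -/
theorem small_radius_step_successful
    {E : Type*} [NormedAddCommGroup E] [InnerProductSpace ℝ E] [FiniteDimensional ℝ E]
    [Nontrivial E] {m : ℕ} (hm : 1 ≤ m)
    (f : E → ℝ) (g : Fin m → E → ℝ)
    (hf : ContDiff ℝ 2 f) (hg : ∀ i, ContDiff ℝ 2 (g i))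
    (x : E) (z : Fin m → ℝ) (μ κC τ : ℝ)
    (hgx : ∀ i, 0 < g i x) (hz : ∀ i, 0 < z i)
    (hμ : 0 < μ) (hκC : 0 < κC) (hτ : 0 < τ ∧ τ < 1/4)
    (hq : qmu μ f g x ≠ 0) :
    ∃ Δbar > (0:ℝ), ∀ Δ : ℝ, 0 < Δ → Δ ≤ Δbar → ∀ d : E, ‖d‖ ≤ Δ →
      κC * ‖qmu μ f g x‖ * Δ ≤ predRed μ f g x z d →
      (∀ i, 0 < g i (x + d)) ∧ τ * predRed μ f g x z d < aredRed μ f g x d := by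
  set a : ℝ := κC * ‖qmu μ f g x‖
  have ha0 : 0 < a := mul_pos hκC (norm_pos_iff.mpr hq)
  have hgrad : HasGradientAt (barrierPhi μ f g) (qmu μ f g x) x :=
    hasGradientAt_barrierPhi μ (hf.differentiable two_ne_zero x)
      (fun i => (hg i).differentiable two_ne_zero x) (fun i => (hgx i).ne')
  have hlin : ∀ᶠ y in 𝓝 x,
      |barrierPhi μ f g y - barrierPhi μ f g x - ⟪qmu μ f g x, y - x⟫| ≤ a / 4 * ‖y - x‖ := by
    simpa using (hasGradientAt_iff_isLittleO.mp hgrad).bound (by positivity : 0 < a / 4)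
  have hfeas : ∀ᶠ y in 𝓝 x, ∀ i, 0 < g i y :=
    eventually_all.mpr fun i => (hg i).continuous.continuousAt.eventually (lt_mem_nhds (hgx i))
  obtain ⟨δ, hδ, hball⟩ := Metric.eventually_nhds_iff.mp (hlin.and hfeas)
  set A := Hxz f g x z with hA
  refine ⟨min (δ / 2) (a / (2 * (‖A‖ + 1))), by positivity, fun Δ hΔ hΔbar d hd hpred => ?_⟩
  have hΔδ : Δ ≤ δ / 2 := hΔbar.trans (min_le_left _ _)
  have hΔA : Δ * (2 * (‖A‖ + 1)) ≤ a :=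
    (le_div_iff₀ (by positivity)).mp (hΔbar.trans (min_le_right _ _))
  obtain ⟨hrem, hpos⟩ := hball (y := x + d) (by simpa using by linarith)
  refine ⟨hpos, ?_⟩
  rw [add_sub_cancel_left] at hrem
  have hrem' : |barrierPhi μ f g (x + d) - barrierPhi μ f g x - ⟪qmu μ f g x, d⟫| ≤ a / 4 * Δ :=
    hrem.trans (by gcongr)
  have hquad := (abs_le.mp (abs_inner_apply_self_le A hd)).1
  have hcurv : ‖A‖ * Δ * Δ ≤ a / 2 * Δ := by
    gcongr
    linarith
  have hτpred : τ * predRed μ f g x z d ≤ 1 / 4 * predRed μ f g x z d :=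
    mul_le_mul_of_nonneg_right hτ.2.le ((mul_pos ha0 hΔ).le.trans hpred)
  have haΔ : 0 < a * Δ := mul_pos ha0 hΔ
  have hup := (abs_le.mp hrem').2
  simp only [predRed, trModel, aredRed, ← hA] at *
  linarith

end
end

section
/- Fix μ > 0 and sequences x^ℓ ∈ E, z^ℓ ∈ ℝ^m, d^ℓ ∈ E (ℓ ∈ ℕ) with g_i(x^ℓ) > 0 and z^ℓ_i > 0 for all ℓ, i. Assume: (a) there are constants C_g, C_G, C_z > 0 with ‖∇g_i(x^ℓ)‖ ≤ C_g, ‖Hess g_i(x^ℓ)‖_op ≤ C_G and z^ℓ_i ≤ C_z for all ℓ, i; (b) there are ε̄ > 0 and δ₀ > 0 such that g_i(x^ℓ + v) ≥ ε̄ for all ℓ, i and all v ∈ E with ‖v‖ ≤ δ₀; (c) there are β₁, δ₁, β₂, δ₂ > 0 such that |⟨∇g_i(x^ℓ+tv) − ∇g_i(x^ℓ), v⟩| ≤ β₁ t‖v‖² whenever t ≥ 0 and t‖v‖ ≤ δ₁, and |⟨(Hess h(x^ℓ+tv) − Hess h(x^ℓ))v, v⟩| ≤ β₂ t‖v‖³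 whenever t ≥ 0 and t‖v‖ ≤ δ₂, for every h ∈ {f, g_1,…,g_m}, every ℓ and every i. Then there exist δ̄ > 0 and β > 0 such that for every ℓ with ‖d^ℓ‖ ≤ δ̄, |pred_{x^ℓ,z^ℓ,μ}(d^ℓ) − ared_{x^ℓ,μ}(d^ℓ)| ≤ β ‖d^ℓ‖². -/
open Filter Topology
open scoped RealInnerProductSpace BigOperators

noncomputable section

variable {E : Type*} [NormedAddCommGroup E] [InnerProductSpace ℝ E] [FiniteDimensional ℝ E]

lemma abs_sub_le_of_abs_deriv_le {p p' : ℝ → ℝ} {C t : ℝ} (hp : ∀ s, HasDerivAt p (p' s) s)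
    (hC : ∀ s ∈ Set.Icc (0 : ℝ) 1, |p' s| ≤ C) (ht : t ∈ Set.Icc (0 : ℝ) 1) :
    |p t - p 0| ≤ C := by
  have hC0 : 0 ≤ C := (abs_nonneg _).trans (hC t ht)
  have h := (convex_Icc (0 : ℝ) 1).norm_image_sub_le_of_norm_hasDerivWithin_le
    (fun s _ => (hp s).hasDerivWithinAt) hC (Set.left_mem_Icc.2 zero_le_one) ht
  rw [sub_zero, Real.norm_eq_abs, Real.norm_eq_abs, abs_of_nonneg ht.1] at h
  exact h.trans (mul_le_of_le_one_right hC0 ht.2)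

lemma hasDerivAt_comp_line {h : E → ℝ} (hh : Differentiable ℝ h) (x v : E) (t : ℝ) :
    HasDerivAt (fun s : ℝ => h (x + s • v)) ⟪gradient h (x + t • v), v⟫ t := by
  have hl : HasDerivAt (fun s : ℝ => x + s • v) v t := by
    simpa using ((hasDerivAt_id t).smul_const v).const_add x
  exact ((hh (x + t • v)).hasGradientAt.hasFDerivAt.comp_hasDerivAt t hl).congr_deriv (by simp)

lemma differentiable_gradient {h : E → ℝ} (hh : ContDiff ℝ 2 h) :
    Differentiable ℝ (gradient h) := by
  have h1 : Differentiable ℝ (fderiv ℝ h) :=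
    (hh.fderiv_right (m := 1) (by norm_num)).differentiable (by norm_num)
  exact (InnerProductSpace.toDual ℝ E).symm.toContinuousLinearEquiv.differentiable.comp h1

lemma hasDerivAt_inner_gradient_line {h : E → ℝ} (hh : ContDiff ℝ 2 h) (x v : E) (t : ℝ) :
    HasDerivAt (fun s : ℝ => ⟪gradient h (x + s • v), v⟫) ⟪Hess h (x + t • v) v, v⟫ t := by
  have hl : HasDerivAt (fun s : ℝ => x + s • v) v t := by
    simpa using ((hasDerivAt_id t).smul_const v).const_add x
  have h1 := (differentiable_gradient hh (x + t • v)).hasFDerivAt.comp_hasDerivAt t hl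
  simpa [Hess] using h1.inner ℝ (hasDerivAt_const t v)

lemma abs_first_order_remainder_le {h : E → ℝ} (hh : Differentiable ℝ h) {x v : E} {C : ℝ}
    (hC : ∀ t ∈ Set.Icc (0 : ℝ) 1, |⟪gradient h (x + t • v) - gradient h x, v⟫| ≤ C) :
    |h (x + v) - h x - ⟪gradient h x, v⟫| ≤ C := by
  have key := abs_sub_le_of_abs_deriv_le (t := 1)
    (p := fun s : ℝ => h (x + s • v) - s * ⟪gradient h x, v⟫)
    (p' := fun s => ⟪gradient h (x + s • v) - gradient h x, v⟫) (C := C) (fun s => by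
      simpa [inner_sub_left] using
        (hasDerivAt_comp_line hh x v s).fun_sub ((hasDerivAt_id s).mul_const ⟪gradient h x, v⟫))
    hC (by simp)
  convert key using 2
  simp
  ring

lemma abs_second_order_remainder_le {h : E → ℝ} (hh : ContDiff ℝ 2 h) {x v : E} {C : ℝ}
    (hC : ∀ t ∈ Set.Icc (0 : ℝ) 1, |⟪(Hess h (x + t • v) - Hess h x) v, v⟫| ≤ C) :
    |h (x + v) - h x - ⟪gradient h x, v⟫ - 1 / 2 * ⟪Hess h x v, v⟫| ≤ C := by
  have hgrad : ∀ t ∈ Set.Icc (0 : ℝ) 1,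
      |⟪gradient h (x + t • v), v⟫ - ⟪gradient h x, v⟫ - t * ⟪Hess h x v, v⟫| ≤ C := by
    intro t ht
    have key := abs_sub_le_of_abs_deriv_le (t := t)
      (p := fun s : ℝ => ⟪gradient h (x + s • v), v⟫ - s * ⟪Hess h x v, v⟫)
      (p' := fun s => ⟪(Hess h (x + s • v) - Hess h x) v, v⟫) (C := C) (fun s => by
        simpa [inner_sub_left] using
          (hasDerivAt_inner_gradient_line hh x v s).fun_sub
            ((hasDerivAt_id s).mul_const ⟪Hess h x v, v⟫))
      hC ht
    convert key using 2
    simp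
    ring
  have hd : ∀ s : ℝ, HasDerivAt
      (fun s : ℝ => h (x + s • v) - s * ⟪gradient h x, v⟫ - s ^ 2 * (1 / 2 * ⟪Hess h x v, v⟫))
      (⟪gradient h (x + s • v), v⟫ - ⟪gradient h x, v⟫ - s * ⟪Hess h x v, v⟫) s := by
    intro s
    have h1 := ((hasDerivAt_comp_line (hh.differentiable (by norm_num)) x v s).fun_sub
      ((hasDerivAt_id s).mul_const ⟪gradient h x, v⟫)).fun_sub
      ((hasDerivAt_pow 2 s).mul_const (1 / 2 * ⟪Hess h x v, v⟫))
    refine h1.congr_deriv ?_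
    push_cast
    ring
  have key := abs_sub_le_of_abs_deriv_le (t := 1) hd hgrad (by simp)
  convert key using 2
  simp
  ring

lemma abs_log_sub_log_sub_div_le {a b ε : ℝ} (hε : 0 < ε) (ha : ε ≤ a) (hb : ε ≤ b) :
    |Real.log b - Real.log a - (b - a) / a| ≤ (b - a) ^ 2 / ε ^ 2 := by
  have ha0 := hε.trans_le ha
  have hb0 := hε.trans_le hb
  have h1 := Real.log_le_sub_one_of_pos (div_pos hb0 ha0)
  have h2 := Real.one_sub_inv_le_log_of_pos (div_pos hb0 ha0)
  rw [Real.log_div hb0.ne' ha0.ne'] at h1 h2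
  have e1 : b / a - 1 = (b - a) / a := by field_simp
  have e2 : 1 - (b / a)⁻¹ = (b - a) / a - (b - a) ^ 2 / (a * b) := by
    field_simp
    ring
  have h3 : (b - a) ^ 2 / (a * b) ≤ (b - a) ^ 2 / ε ^ 2 := by
    rw [sq ε]
    gcongr
  rw [abs_le]
  constructor
  · linarith
  · have := div_nonneg (sq_nonneg (b - a)) (sq_nonneg ε)
    linarith

lemma predRed_sub_aredRed_eq {m : ℕ} (μ : ℝ) (f : E → ℝ) (g : Fin m → E → ℝ) (x : E)
    (z : Fin m → ℝ) (d : E) :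
    predRed μ f g x z d - aredRed μ f g x d =
      (f (x + d) - f x - ⟪gradient f x, d⟫ - 1 / 2 * ⟪Hess f x d, d⟫) +
      ∑ i, (1 / 2 * z i * ⟪Hess (g i) x d, d⟫
        - 1 / 2 * (z i / g i x) * ⟪gradient (g i) x, d⟫ ^ 2
        - μ * (Real.log (g i (x + d)) - Real.log (g i x) - ⟪gradient (g i) x, d⟫ / g i x)) := by
  simp only [predRed, aredRed, trModel, barrierPhi, Hxz, hessL, qmu, inner_add_left,
    inner_sub_left, sum_inner, real_inner_smul_left, add_apply,
    sub_apply, sum_apply, smul_apply,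
    ContinuousLinearMap.smulRight_apply, innerSL_apply_apply, Finset.sum_sub_distrib, mul_sub,
    mul_add, mul_assoc, ← Finset.mul_sum, ← sq, div_eq_inv_mul]
  ring

lemma abs_barrier_term_le {E : Type*} [NormedAddCommGroup E] [InnerProductSpace ℝ E]
    {a b z μ ε Cg CG Cz β : ℝ} {A : E →L[ℝ] E} {p d : E}
    (hε : 0 < ε) (hμ : 0 < μ) (ha : ε ≤ a) (hb : ε ≤ b) (hz : 0 < z) (hzC : z ≤ Cz)
    (hA : ‖A‖ ≤ CG) (hp : ‖p‖ ≤ Cg) (hβ : 0 ≤ β) (hd : ‖d‖ ≤ 1)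
    (hr : |b - a - ⟪p, d⟫| ≤ β * ‖d‖ ^ 2) :
    |1 / 2 * z * ⟪A d, d⟫ - 1 / 2 * (z / a) * ⟪p, d⟫ ^ 2
        - μ * (Real.log b - Real.log a - ⟪p, d⟫ / a)| ≤
      (Cz * CG + Cz / ε * Cg ^ 2 + μ * ((Cg + β) ^ 2 / ε ^ 2 + β / ε)) * ‖d‖ ^ 2 := by
  have ha0 := hε.trans_le ha
  have hCz : 0 < Cz := hz.trans_le hzC
  have hin : |⟪p, d⟫| ≤ Cg * ‖d‖ :=
    (abs_real_inner_le_norm p d).trans (by gcongr)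
  have hq : |⟪A d, d⟫| ≤ CG * ‖d‖ ^ 2 := calc
    |⟪A d, d⟫| ≤ ‖A d‖ * ‖d‖ := abs_real_inner_le_norm _ _
    _ ≤ CG * ‖d‖ * ‖d‖ := by
      gcongr
      exact A.le_of_opNorm_le hA d
    _ = CG * ‖d‖ ^ 2 := by ring
  have h1 : |1 / 2 * z * ⟪A d, d⟫| ≤ Cz * (CG * ‖d‖ ^ 2) := by
    rw [abs_mul, abs_of_pos (by positivity)]
    gcongr
    linarith
  have h2 : |1 / 2 * (z / a) * ⟪p, d⟫ ^ 2| ≤ Cz / ε * (Cg * ‖d‖) ^ 2 := by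
    rw [abs_mul, abs_of_pos (by positivity), abs_pow]
    have hza : z / a ≤ Cz / ε := by gcongr
    have : 0 < z / a := by positivity
    gcongr
    linarith
  have hba : |b - a| ≤ (Cg + β) * ‖d‖ := by
    have h := abs_add_le (b - a - ⟪p, d⟫) ⟪p, d⟫
    rw [sub_add_cancel] at h
    have : β * ‖d‖ ^ 2 ≤ β * ‖d‖ := by
      gcongr
      exact pow_le_of_le_one (norm_nonneg d) hd two_ne_zero
    linarith
  have h3 : |Real.log b - Real.log a - ⟪p, d⟫ / a| ≤
      ((Cg + β) * ‖d‖) ^ 2 / ε ^ 2 + β * ‖d‖ ^ 2 / ε := by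
    have e : Real.log b - Real.log a - ⟪p, d⟫ / a =
        (Real.log b - Real.log a - (b - a) / a) + (b - a - ⟪p, d⟫) / a := by ring
    rw [e]
    refine (abs_add_le _ _).trans (add_le_add ?_ ?_)
    · refine (abs_log_sub_log_sub_div_le hε ha hb).trans ?_
      rw [← sq_abs]
      gcongr
    · rw [abs_div, abs_of_pos ha0]
      gcongr
  have h4 : |μ * (Real.log b - Real.log a - ⟪p, d⟫ / a)| ≤
      μ * (((Cg + β) * ‖d‖) ^ 2 / ε ^ 2 + β * ‖d‖ ^ 2 / ε) := by
    rw [abs_mul, abs_of_pos hμ]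
    gcongr
  calc _ ≤ Cz * (CG * ‖d‖ ^ 2) + Cz / ε * (Cg * ‖d‖) ^ 2
        + μ * (((Cg + β) * ‖d‖) ^ 2 / ε ^ 2 + β * ‖d‖ ^ 2 / ε) :=
      (abs_sub _ _).trans (add_le_add ((abs_sub _ _).trans (add_le_add h1 h2)) h4)
    _ = _ := by ring

/-- Uniform quadratic bound on the gap between predicted and actual
reductions along the inner iterates. -/
theorem pred_ared_gap_quadratic_uniform
    {E : Type*} [NormedAddCommGroup E] [InnerProductSpace ℝ E] [FiniteDimensional ℝ E]
    [Nontrivial E] {m : ℕ} (hm : 1 ≤ m)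
    (f : E → ℝ) (g : Fin m → E → ℝ)
    (hf : ContDiff ℝ 2 f) (hg : ∀ i, ContDiff ℝ 2 (g i))
    (μ : ℝ) (hμ : 0 < μ)
    (x : ℕ → E) (z : ℕ → Fin m → ℝ) (d : ℕ → E)
    (hgpos : ∀ ℓ i, 0 < g i (x ℓ)) (hzpos : ∀ ℓ i, 0 < z ℓ i)
    -- (a) uniform bounds
    (Cg CG Cz : ℝ) (hCg : 0 < Cg) (hCG : 0 < CG) (hCz : 0 < Cz)
    (hgradb : ∀ ℓ i, ‖gradient (g i) (x ℓ)‖ ≤ Cg)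
    (hhessb : ∀ ℓ i, ‖Hess (g i) (x ℓ)‖ ≤ CG)
    (hzb : ∀ ℓ i, z ℓ i ≤ Cz)
    -- (b) uniform strict feasibility in a neighborhood of the iterates
    (εb δ₀ : ℝ) (hεb : 0 < εb) (hδ₀ : 0 < δ₀)
    (hglow : ∀ ℓ i, ∀ v : E, ‖v‖ ≤ δ₀ → εb ≤ g i (x ℓ + v))
    -- (c) radial Lipschitz bounds
    (β₁ δ₁ β₂ δ₂ : ℝ) (hβ₁ : 0 < β₁) (hδ₁ : 0 < δ₁) (hβ₂ : 0 < β₂) (hδ₂ : 0 < δ₂)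
    (hrad1 : ∀ ℓ i (t : ℝ) (v : E), 0 ≤ t → t * ‖v‖ ≤ δ₁ →
      |⟪gradient (g i) (x ℓ + t • v) - gradient (g i) (x ℓ), v⟫| ≤ β₁ * t * ‖v‖ ^ 2)
    (hrad2f : ∀ ℓ (t : ℝ) (v : E), 0 ≤ t → t * ‖v‖ ≤ δ₂ →
      |⟪(Hess f (x ℓ + t • v) - Hess f (x ℓ)) v, v⟫| ≤ β₂ * t * ‖v‖ ^ 3)
    (hrad2g : ∀ ℓ i (t : ℝ) (v : E), 0 ≤ t → t * ‖v‖ ≤ δ₂ →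
      |⟪(Hess (g i) (x ℓ + t • v) - Hess (g i) (x ℓ)) v, v⟫| ≤ β₂ * t * ‖v‖ ^ 3) :
    ∃ δbar > (0:ℝ), ∃ β > (0:ℝ), ∀ ℓ, ‖d ℓ‖ ≤ δbar →
      |predRed μ f g (x ℓ) (z ℓ) (d ℓ) - aredRed μ f g (x ℓ) (d ℓ)| ≤ β * ‖d ℓ‖ ^ 2 := by
  set K := Cz * CG + Cz / εb * Cg ^ 2 + μ * ((Cg + β₁) ^ 2 / εb ^ 2 + β₁ / εb) with hK
  refine ⟨min (min δ₀ δ₁) (min δ₂ 1), by positivity, β₂ + m * K, by positivity, ?_⟩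
  intro ℓ hd
  simp only [le_min_iff] at hd
  obtain ⟨⟨hd0, hd1⟩, hd2, hd3⟩ := hd
  have hscale : ∀ t ∈ Set.Icc (0 : ℝ) 1, t * ‖d ℓ‖ ≤ ‖d ℓ‖ := fun t ht =>
    mul_le_of_le_one_left (norm_nonneg _) ht.2
  have hF : |f (x ℓ + d ℓ) - f (x ℓ) - ⟪gradient f (x ℓ), d ℓ⟫
      - 1 / 2 * ⟪Hess f (x ℓ) (d ℓ), d ℓ⟫| ≤ β₂ * ‖d ℓ‖ ^ 2 := by
    refine abs_second_order_remainder_le hf fun t ht =>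
      (hrad2f ℓ t (d ℓ) ht.1 ((hscale t ht).trans hd2)).trans ?_
    calc β₂ * t * ‖d ℓ‖ ^ 3 ≤ β₂ * 1 * ‖d ℓ‖ ^ 2 := by
          have h1 := pow_le_pow_of_le_one (norm_nonneg (d ℓ)) hd3 (show 2 ≤ 3 by norm_num)
          have h2 := ht.2
          gcongr ?_ * ?_
          gcongr
      _ = β₂ * ‖d ℓ‖ ^ 2 := by ring
  rw [predRed_sub_aredRed_eq, add_mul]
  refine (abs_add_le _ _).trans (add_le_add hF ?_)
  refine (Finset.abs_sum_le_sum_abs _ _).trans ((Finset.sum_le_card_nsmul _ _ (K * ‖d ℓ‖ ^ 2)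
    fun i _ => ?_).trans_eq (by simp [mul_assoc]))
  refine abs_barrier_term_le hεb hμ (by simpa using hglow ℓ i 0 (by simpa using hδ₀.le))
    (hglow ℓ i _ hd0) (hzpos ℓ i) (hzb ℓ i) (hhessb ℓ i) (hgradb ℓ i) hβ₁.le hd3 ?_
  refine abs_first_order_remainder_le ((hg i).differentiable (by norm_num)) fun t ht =>
    (hrad1 ℓ i t (d ℓ) ht.1 ((hscale t ht).trans hd1)).trans ?_
  gcongr
  exact mul_le_of_le_one_right hβ₁.le ht.2

end
end
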